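/- Let J be an abelian complex structure on an (s+1)-step nilpotent Lie algebra g with dim_C c^{1,0} = 1, and Λ = C ∧ V with C spanning t^{s+1,(1,0)} and V ∈ t^{s,(1,0)}. Then for any ω̄ ∈ t^{m,*(0,1)}, the bracket [V, ω̄] vanishes unless m = s+1, and [V, t^{s+1,*(0,1)}] ⊆ ⊕_{ℓ≤s} t^{ℓ,*(0,1)}. -/

import Mathlib

open scoped TensorProduct

noncomputable section

variable (g : Type*) [LieRing g] [LieAlgebra ℝ g]

/-- The canonical inclusion of `g` in its complexification `ℂ ⊗[ℝ] g`. -/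
def cx (X : g) : ℂ ⊗[ℝ] g := (1 : ℂ) ⊗ₜ[ℝ] X

/-- The `(1,0)`-vector `X - i J X` associated to `X ∈ g`. -/
def pOne (J : g →ₗ[ℝ] g) (X : g) : ℂ ⊗[ℝ] g := cx g X - Complex.I • cx g (J X)

/-- The `(0,1)`-vector `X + i J X` associated to `X ∈ g`. -/
def pBar (J : g →ₗ[ℝ] g) (X : g) : ℂ ⊗[ℝ] g := cx g X + Complex.I • cx g (J X)

/-- The `k`-th term `g^k` of the descending central series:
`g^0 = g`, `g^{k+1} = [g^k, g]`. -/
def dcs (k : ℕ) : Submodule ℝ g := (LieModule.lowerCentralSeries ℝ g g k).toSubmodule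

/-- `g_J^k = g^k + J g^k`. -/
def gJ (J : g →ₗ[ℝ] g) (k : ℕ) : Submodule ℝ g := dcs g k ⊔ (dcs g k).map J

/-- `g^{1,0}`, the `+i` eigenspace of `J` in `g_ℂ`. -/
def gOneZero (J : g →ₗ[ℝ] g) : Submodule ℂ (ℂ ⊗[ℝ] g) :=
  Submodule.span ℂ {v | ∃ X : g, v = pOne g J X}

/-- `g^{0,1}`, the `-i` eigenspace of `J` in `g_ℂ`. -/
def gZeroOne (J : g →ₗ[ℝ] g) : Submodule ℂ (ℂ ⊗[ℝ] g) :=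
  Submodule.span ℂ {v | ∃ X : g, v = pBar g J X}

/-- `g_J^{k,(1,0)}`, the `(1,0)`-part of the complexification of `g_J^k`. -/
def gJOneZero (J : g →ₗ[ℝ] g) (k : ℕ) : Submodule ℂ (ℂ ⊗[ℝ] g) :=
  Submodule.span ℂ {v | ∃ X ∈ gJ g J k, v = pOne g J X}

/-- `g_J^{k,(0,1)}`, the `(0,1)`-part of the complexification of `g_J^k`. -/
def gJZeroOne (J : g →ₗ[ℝ] g) (k : ℕ) : Submodule ℂ (ℂ ⊗[ℝ] g) :=
  Submodule.span ℂ {v | ∃ X ∈ gJ g J k, v = pBar g J X}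

/-- The complexification `S_ℂ ⊆ g_ℂ` of a real subspace `S ⊆ g`. -/
def cxSpan (S : Submodule ℝ g) : Submodule ℂ (ℂ ⊗[ℝ] g) :=
  Submodule.span ℂ {v | ∃ X ∈ S, v = cx g X}

/-- The projection `g_ℂ → g^{1,0}`, `v ↦ (v - i J v)/2`. -/
def projOneZero (J : g →ₗ[ℝ] g) : (ℂ ⊗[ℝ] g) →ₗ[ℂ] (ℂ ⊗[ℝ] g) :=
  (1 / 2 : ℂ) • (LinearMap.id - Complex.I • LinearMap.baseChange ℂ J)

/-- `c^{1,0}`, the `(1,0)`-part of the complexified center of `g`. -/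
def cOneZero (J : g →ₗ[ℝ] g) : Submodule ℂ (ℂ ⊗[ℝ] g) :=
  Submodule.span ℂ {v | ∃ X ∈ LieAlgebra.center ℝ g, v = pOne g J X}

theorem aux_cx_bracket (X Y : g) : ⁅cx g X, cx g Y⁆ = cx g ⁅X, Y⁆ := by
  simp [cx, LieAlgebra.ExtendScalars.bracket_tmul]

theorem aux_lie_add (x y z : ℂ ⊗[ℝ] g) : ⁅x, y + z⁆ = ⁅x, y⁆ + ⁅x, z⁆ :=
  LieRing.lie_add x y z

theorem aux_sub_lie (x y z : ℂ ⊗[ℝ] g) : ⁅x - y, z⁆ = ⁅x, z⁆ - ⁅y, z⁆ :=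
  sub_lie (L := ℂ ⊗[ℝ] g) (M := ℂ ⊗[ℝ] g) x y z

theorem aux_lie_smul (c : ℂ) (x y : ℂ ⊗[ℝ] g) : ⁅x, c • y⁆ = c • ⁅x, y⁆ :=
  LieAlgebra.lie_smul c x y

theorem aux_smul_lie (c : ℂ) (x y : ℂ ⊗[ℝ] g) : ⁅c • x, y⁆ = c • ⁅x, y⁆ :=
  smul_lie (L := ℂ ⊗[ℝ] g) (M := ℂ ⊗[ℝ] g) c x y

theorem aux_lie_zero (x : ℂ ⊗[ℝ] g) : ⁅x, (0 : ℂ ⊗[ℝ] g)⁆ = 0 :=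
  lie_zero (L := ℂ ⊗[ℝ] g) (M := ℂ ⊗[ℝ] g) x

theorem aux_bracket (J : g →ₗ[ℝ] g) (hJ2 : ∀ X : g, J (J X) = -X)
    (habelian : ∀ A B : g, ⁅J A, J B⁆ = ⁅A, B⁆) (X Z : g) :
    ⁅pOne g J X, pBar g J Z⁆ =
      (2 : ℂ) • cx g ⁅X, Z⁆ + (2 * Complex.I) • cx g ⁅X, J Z⁆ := by
  have h1 : ⁅J X, Z⁆ = -⁅X, J Z⁆ := by
    have := habelian (J X) Z
    rw [hJ2, neg_lie] at this
    exact this.symm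
  have h2 : cx g (-⁅X, J Z⁆) = -cx g ⁅X, J Z⁆ := by
    exact TensorProduct.tmul_neg _ _
  simp only [pOne, pBar, aux_sub_lie, aux_lie_add, aux_smul_lie, aux_lie_smul, aux_cx_bracket, habelian, h1, h2,
    smul_neg]
  match_scalars
  · linear_combination -Complex.I_mul_I
  · ring

theorem aux_mem (J : g →ₗ[ℝ] g) (hJ2 : ∀ X : g, J (J X) = -X)
    (habelian : ∀ A B : g, ⁅J A, J B⁆ = ⁅A, B⁆) (k : ℕ) (X : g) (hX : X ∈ gJ g J k) (Z : g) :
    ⁅X, Z⁆ ∈ dcs g (k + 1) := by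
  have key : ∀ a ∈ dcs g k, ∀ z : g, ⁅a, z⁆ ∈ dcs g (k + 1) := by
    intro a ha z
    rw [← lie_skew]
    refine Submodule.neg_mem _ ?_
    change ⁅z, a⁆ ∈ LieModule.lowerCentralSeries ℝ g g (k + 1)
    rw [LieModule.lowerCentralSeries_succ]
    exact LieSubmodule.lie_mem_lie (LieSubmodule.mem_top z) ha
  obtain ⟨a, ha, c, hc, rfl⟩ := Submodule.mem_sup.1 hX
  obtain ⟨b, hb, rfl⟩ := Submodule.mem_map.1 hc
  rw [add_lie]
  refine Submodule.add_mem _ (key a ha Z) ?_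
  have h := habelian (J b) Z
  rw [hJ2, neg_lie] at h
  rw [← h]
  exact Submodule.neg_mem _ (key b hb _)

theorem aux_J_mem (J : g →ₗ[ℝ] g) (hJ2 : ∀ X : g, J (J X) = -X) (k : ℕ) (X : g)
    (hX : X ∈ gJ g J k) : J X ∈ gJ g J k := by
  obtain ⟨a, ha, c, hc, rfl⟩ := Submodule.mem_sup.1 hX
  obtain ⟨b, hb, rfl⟩ := Submodule.mem_map.1 hc
  rw [map_add, hJ2, add_comm]
  exact Submodule.mem_sup.2 ⟨_, Submodule.neg_mem _ hb, _, Submodule.mem_map_of_mem ha, rfl⟩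

/-- Let `J` be an abelian complex structure on an `(s+1)`-step nilpotent
Lie algebra `g` with `dim_ℂ c^{1,0} = 1`, and `Λ = C ∧ V` with `C` spanning
`t^{s+1,(1,0)} = g_J^{s,(1,0)}` and `V ∈ t^{s,(1,0)} ⊆ g_J^{s-1,(1,0)}`.  Then for any
`(0,1)`-form `ω̄ ∈ t^{m,*(0,1)}` (i.e. `ω̄` annihilates `g^{1,0}` and `g_J^{m,(0,1)}`)
with `m ≤ s`, the bracket `[V,ω̄] = ι_V dω̄ : Y ↦ -ω̄([V,Y])` vanishes; and
`[V, t^{s+1,*(0,1)}] ⊆ ⊕_{ℓ≤s} t^{ℓ,*(0,1)}`, i.e. for any `(0,1)`-form `ω̄`,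
`[V,ω̄]` annihilates `g_J^{s,(0,1)}`. -/
theorem bracket_V_forms (g : Type*) [LieRing g] [LieAlgebra ℝ g]
    [FiniteDimensional ℝ g]
    (J : g →ₗ[ℝ] g) (hJ2 : ∀ X : g, J (J X) = -X)
    (habelian : ∀ A B : g, ⁅J A, J B⁆ = ⁅A, B⁆)
    (s : ℕ) (hs : 1 ≤ s)
    (hstep : dcs g (s + 1) = ⊥) (hsne : dcs g s ≠ ⊥)
    (hdim : Module.finrank ℂ (cOneZero g J) = 1)
    (Xc : g) (hXc : Xc ∈ gJ g J s) (hCne : pOne g J Xc ≠ 0)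
    (hCspan : Submodule.span ℂ {pOne g J Xc} = gJOneZero g J s)
    (Xv : g) (hXv : Xv ∈ gJ g J (s - 1)) :
    (∀ m : ℕ, 1 ≤ m → m ≤ s →
      ∀ ω : (ℂ ⊗[ℝ] g) →ₗ[ℂ] ℂ,
        (∀ v ∈ gOneZero g J, ω v = 0) → (∀ v ∈ gJZeroOne g J m, ω v = 0) →
        ∀ Y ∈ gZeroOne g J, -ω ⁅pOne g J Xv, Y⁆ = 0) ∧
    (∀ ω : (ℂ ⊗[ℝ] g) →ₗ[ℂ] ℂ,
        (∀ v ∈ gOneZero g J, ω v = 0) →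
        ∀ Y ∈ gJZeroOne g J s, -ω ⁅pOne g J Xv, Y⁆ = 0) := by
  constructor
  · intro m _ hms ω h1 h2 Y hY
    have hcx : ∀ W ∈ dcs g s, ω (cx g W) = 0 := by
      intro W hW
      have hWm : W ∈ gJ g J m :=
        Submodule.mem_sup_left (LieModule.antitone_lowerCentralSeries ℝ g g hms hW)
      have e1 := h1 _ (Submodule.subset_span ⟨W, rfl⟩)
      have e2 := h2 _ (Submodule.subset_span ⟨W, hWm, rfl⟩)
      simp only [pOne, pBar, map_sub, map_add] at e1 e2
      linear_combination (e1 + e2) / 2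
    have hb : ∀ Z : g, ⁅Xv, Z⁆ ∈ dcs g s := by
      intro Z
      have := aux_mem g J hJ2 habelian (s - 1) Xv hXv Z
      rwa [Nat.sub_add_cancel hs] at this
    rw [neg_eq_zero]
    induction hY using Submodule.span_induction with
    | mem y hy =>
      obtain ⟨Z, rfl⟩ := hy
      rw [aux_bracket g J hJ2 habelian, map_add, map_smul, map_smul, hcx _ (hb _), hcx _ (hb _)]
      simp
    | zero => rw [aux_lie_zero, map_zero]
    | add x y _ _ hx hy => rw [aux_lie_add, map_add, hx, hy, add_zero]
    | smul c x _ hx => rw [aux_lie_smul, map_smul, hx, smul_zero]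
  · intro ω _ Y hY
    have hz : ∀ Z ∈ gJ g J s, ⁅Xv, Z⁆ = 0 := by
      intro Z hZ
      have := aux_mem g J hJ2 habelian s Z hZ Xv
      rw [hstep, Submodule.mem_bot] at this
      rw [← lie_skew, this, neg_zero]
    rw [neg_eq_zero]
    induction hY using Submodule.span_induction with
    | mem y hy =>
      obtain ⟨Z, hZ, rfl⟩ := hy
      rw [aux_bracket g J hJ2 habelian, hz _ hZ, hz _ (aux_J_mem g J hJ2 s Z hZ)]
      simp [cx]
    | zero => rw [aux_lie_zero, map_zero]
    | add x y _ _ hx hy => rw [aux_lie_add, map_add, hx, hy, add_zero]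
    | smul c x _ hx => rw [aux_lie_smul, map_smul, hx, smul_zero]

end
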